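/- arXiv:1507.00123 — 3 statements merged into one kernel-verified Lean document; each statement's English description precedes it below -/
import Mathlib

section
/- Let l, r, K be positive integers with r ≤ l and r ≤ K. Let U ∈ ℝ^{l×r} have rank r and Z = [z₁,…,z_K] ∈ ℝ^{r×K} have rank r. Define J ∈ ℝ^{lK×(lr+Kr)} to be the block matrix whose k-th block row (of height l), for k = 1,…,K, is [z_kᵀ ⊗ I_l, 0, …, 0, U, 0, …, 0], i.e. the first lr columns of J are the vertical stack of the matrices z_kᵀ ⊗ I_l and the last Kr columns form a block-diagonal matrix with K diagonal blocks each equal to U. Then rank(J) = lr + Kr − r². -/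
open Matrix

theorem exists_right_inv_of_rank {r K : ℕ} (Z : Matrix (Fin r) (Fin K) ℝ) (hZ : Z.rank = r) :
    ∃ R : Matrix (Fin K) (Fin r) ℝ, Z * R = 1 := by
  rw [← Matrix.mulVec_surjective_iff_exists_right_inverse]
  have h : LinearMap.range Z.mulVecLin = ⊤ := by
    apply Submodule.eq_top_of_finrank_eq
    rw [Module.finrank_fin_fun]
    exact hZ
  exact LinearMap.range_eq_top.mp h

/-- Let `l, r, K` be positive integers with `r ≤ l` and `r ≤ K`.
Let `U ∈ ℝ^{l×r}` have rank `r` and `Z = [z₁,…,z_K] ∈ ℝ^{r×K}` have rank `r`.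
Define `J ∈ ℝ^{lK×(lr+Kr)}` to be the block matrix whose `k`-th block row (of height `l`)
is `[z_kᵀ ⊗ I_l, 0, …, 0, U, 0, …, 0]`: the first `lr` columns of `J` are the vertical
stack of the matrices `z_kᵀ ⊗ I_l` and the last `Kr` columns form a block-diagonal matrix
with `K` diagonal blocks each equal to `U`.  Then `rank(J) = lr + Kr − r²`.

Rows are indexed by `Fin K × Fin l` (`k`-th block row, row `i` within the block), the first
group of columns by `Fin r × Fin l` (`j`-th block of `l` columns, column `a` within the block;
the entry of `z_kᵀ ⊗ I_l` there is `Z j k · δ_{i a}`), and the second group of columns by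
`Fin K × Fin r` (`k'`-th diagonal block, column `j` of `U`). -/
theorem rank_jacobian_of_bilinear_parametrization
    (l r K : ℕ) (hl : 0 < l) (hr : 0 < r) (hK : 0 < K) (hrl : r ≤ l) (hrK : r ≤ K)
    (U : Matrix (Fin l) (Fin r) ℝ) (Z : Matrix (Fin r) (Fin K) ℝ)
    (hU : U.rank = r) (hZ : Z.rank = r)
    (J : Matrix (Fin K × Fin l) ((Fin r × Fin l) ⊕ (Fin K × Fin r)) ℝ)
    (hJl : ∀ (k : Fin K) (i : Fin l) (j : Fin r) (a : Fin l),
      J (k, i) (Sum.inl (j, a)) = Z j k * (if i = a then 1 else 0))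
    (hJr : ∀ (k : Fin K) (i : Fin l) (k' : Fin K) (j : Fin r),
      J (k, i) (Sum.inr (k', j)) = if k = k' then U i j else 0) :
    J.rank = l * r + K * r - r ^ 2 := by
  obtain ⟨R, hR⟩ := exists_right_inv_of_rank Z hZ
  obtain ⟨L', hL'⟩ := exists_right_inv_of_rank Uᵀ (by rw [Matrix.rank_transpose]; exact hU)
  have hL : L'ᵀ * U = 1 := by
    rw [← Matrix.transpose_transpose U, ← Matrix.transpose_mul, hL', Matrix.transpose_one]
  have key : ∀ v : (Fin r × Fin l) ⊕ (Fin K × Fin r) → ℝ, J *ᵥ v = 0 ↔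
      (Matrix.of fun i j => v (Sum.inl (j, i))) * Z
        + U * (Matrix.of fun j k => v (Sum.inr (k, j))) = 0 := by
    intro v
    have e : ∀ k i, (J *ᵥ v) (k, i) = ((Matrix.of fun i j => v (Sum.inl (j, i))) * Z
        + U * (Matrix.of fun j k => v (Sum.inr (k, j))) : Matrix (Fin l) (Fin K) ℝ) i k := by
      intro k i
      simp [Matrix.mulVec, dotProduct, Fintype.sum_sum_type, Fintype.sum_prod_type, hJl, hJr,
        Matrix.mul_apply, mul_comm, Finset.sum_ite_eq, ite_mul]
    constructor
    · intro h
      ext i k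
      rw [← e, h]; rfl
    · intro h
      ext ⟨k, i⟩
      rw [e, h]; rfl
  let φ : Matrix (Fin r) (Fin r) ℝ →ₗ[ℝ] ((Fin r × Fin l) ⊕ (Fin K × Fin r) → ℝ) :=
    { toFun := fun S => Sum.elim (fun p => -(U * S) p.2 p.1) (fun p => (S * Z) p.2 p.1)
      map_add' := by
        intro S T
        ext (p | p)
        · simp [Matrix.mul_add]; ring
        · simp [Matrix.add_mul]
      map_smul' := by
        intro c S
        ext (p | p) <;> simp }
  have hinj : Function.Injective φ := by
    intro S T h
    have h2 : S * Z = T * Z := by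
      ext j k
      exact congrFun h (Sum.inr (k, j))
    have h3 := congrArg (· * R) h2
    simpa [Matrix.mul_assoc, hR] using h3
  have hrange : LinearMap.range φ = LinearMap.ker J.mulVecLin := by
    ext v
    rw [LinearMap.mem_ker, Matrix.mulVecLin_apply, key, LinearMap.mem_range]
    constructor
    · rintro ⟨S, rfl⟩
      have h1 : (Matrix.of fun i j => φ S (Sum.inl (j, i))) = -(U * S) := rfl
      have h2 : (Matrix.of fun j k => φ S (Sum.inr (k, j))) = S * Z := rfl
      rw [h1, h2, Matrix.neg_mul, Matrix.mul_assoc, neg_add_cancel]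
    · intro h
      set A : Matrix (Fin l) (Fin r) ℝ := Matrix.of fun i j => v (Sum.inl (j, i)) with hA
      set B : Matrix (Fin r) (Fin K) ℝ := Matrix.of fun j k => v (Sum.inr (k, j)) with hB
      have hAe : A = -(U * (B * R)) := by
        have h3 := congrArg (· * R) h
        simp only [Matrix.add_mul, Matrix.mul_assoc, hR, Matrix.mul_one, Matrix.zero_mul] at h3
        exact eq_neg_of_add_eq_zero_left h3
      have hBe : B = B * R * Z := by
        have h3 := congrArg (L'ᵀ * ·) h
        simp only [Matrix.mul_add, Matrix.mul_zero, hAe] at h3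
        rw [← Matrix.mul_assoc L'ᵀ U B, hL, Matrix.one_mul, Matrix.neg_mul, Matrix.mul_neg,
          Matrix.mul_assoc U, ← Matrix.mul_assoc L'ᵀ U, hL, Matrix.one_mul] at h3
        exact (neg_add_eq_zero.mp h3).symm
      refine ⟨B * R, ?_⟩
      ext (p | p)
      · exact (congrFun (congrFun hAe p.2) p.1).symm
      · exact (congrFun (congrFun hBe p.2) p.1).symm
  have hk : Module.finrank ℝ (LinearMap.ker J.mulVecLin) = r * r := by
    rw [← hrange, LinearMap.finrank_range_of_inj hinj, Module.finrank_matrix]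
    simp
  have hrn := LinearMap.finrank_range_add_finrank_ker J.mulVecLin
  rw [hk] at hrn
  simp only [Module.finrank_fintype_fun_eq_card, Fintype.card_sum, Fintype.card_prod,
    Fintype.card_fin] at hrn
  have : J.rank = Module.finrank ℝ (LinearMap.range J.mulVecLin) := rfl
  rw [this, pow_two, mul_comm l r]
  omega
end

section
/- Let J be a real m×q matrix and D a real symmetric positive definite m×m matrix whose largest eigenvalue is at most c, where c > 0. Then trace((Jᵀ D J)† (Jᵀ J)) ≥ rank(J)/c, where M† denotes the Moore–Penrose pseudoinverse of M. -/
open Matrix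

open scoped MatrixOrder in
theorem posSemidef_factor {m : ℕ} {D : Matrix (Fin m) (Fin m) ℝ} (hD : D.PosSemidef) :
    ∃ S : Matrix (Fin m) (Fin m) ℝ, D = Sᴴ * S :=
  CStarAlgebra.nonneg_iff_eq_star_mul_self.1 hD.nonneg

/-- Let `J` be a real `m×q` matrix and `D` a real symmetric positive definite
`m×m` matrix whose largest eigenvalue is at most `c`, where `c > 0`.  Then
`trace((Jᵀ D J)† (Jᵀ J)) ≥ rank(J)/c`, where `M†` denotes the Moore–Penrose pseudoinverse
of `M`.

The Moore–Penrose pseudoinverse `X = (Jᵀ D J)†` is characterized (uniquely) by the four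
Penrose conditions, which are taken as hypotheses `hX1`–`hX4` below. -/
theorem trace_pinv_fisher_mul_ge_rank_div
    (m q : ℕ) (J : Matrix (Fin m) (Fin q) ℝ) (D : Matrix (Fin m) (Fin m) ℝ)
    (hD : D.PosDef) (c : ℝ) (hc : 0 < c)
    (hDc : ∀ i, hD.1.eigenvalues i ≤ c)
    (X : Matrix (Fin q) (Fin q) ℝ)
    (hX1 : (Jᵀ * D * J) * X * (Jᵀ * D * J) = Jᵀ * D * J)
    (hX2 : X * (Jᵀ * D * J) * X = X)
    (hX3 : ((Jᵀ * D * J) * X)ᵀ = (Jᵀ * D * J) * X)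
    (hX4 : (X * (Jᵀ * D * J))ᵀ = X * (Jᵀ * D * J)) :
    (J.rank : ℝ) / c ≤ (X * (Jᵀ * J)).trace := by
  have hB : (c • (1 : Matrix (Fin m) (Fin m) ℝ) - D).PosSemidef := by
    have h := hD.1.spectral_theorem
    have h2 : c • (1 : Matrix (Fin m) (Fin m) ℝ) - D
        = (hD.1.eigenvectorUnitary : Matrix (Fin m) (Fin m) ℝ)
          * diagonal (fun i => c - hD.1.eigenvalues i)
          * (hD.1.eigenvectorUnitary : Matrix (Fin m) (Fin m) ℝ)ᴴ := by
      have h3 : diagonal (fun i => c - hD.1.eigenvalues i)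
          = c • (1 : Matrix (Fin m) (Fin m) ℝ) - diagonal hD.1.eigenvalues := by
        ext i j
        by_cases hij : i = j <;> simp [hij, Matrix.one_apply, diagonal_apply]
      have h4 : (hD.1.eigenvectorUnitary : Matrix (Fin m) (Fin m) ℝ)
          * (hD.1.eigenvectorUnitary : Matrix (Fin m) (Fin m) ℝ)ᴴ = 1 :=
        Unitary.mul_star_self_of_mem hD.1.eigenvectorUnitary.2
      rw [h3, Matrix.mul_sub, Matrix.sub_mul, Matrix.mul_smul, Matrix.smul_mul, Matrix.mul_one, h4]
      congr 1
    rw [h2]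
    exact (PosSemidef.diagonal (fun i => sub_nonneg.2 (hDc i))).mul_mul_conjTranspose_same _
  obtain ⟨S, hSu, hS⟩ : ∃ S : Matrix (Fin m) (Fin m) ℝ, IsUnit S.det ∧ D = Sᵀ * S := by
    obtain ⟨S, hS⟩ := posSemidef_factor hD.posSemidef
    rw [conjTranspose_eq_transpose_of_trivial] at hS
    refine ⟨S, ?_, hS⟩
    have := hD.det_pos
    rw [hS, det_mul] at this
    exact isUnit_iff_ne_zero.2 (fun h => by simp [h] at this)
  set A := Jᵀ * D * J with hA
  have hDt : Dᵀ = D := by rw [hS]; simp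
  have hAt : Aᵀ = A := by rw [hA]; simp [hDt, Matrix.mul_assoc]
  have hrA : A.rank = J.rank := by
    have : A = (S * J)ᵀ * (S * J) := by rw [hA, hS]; simp [Matrix.mul_assoc]
    rw [this, rank_transpose_mul_self, rank_mul_eq_right_of_isUnit_det _ _ hSu]
  have h3 : Xᵀ * A = A * X := by simpa [hAt] using hX3
  have h4 : A * Xᵀ = X * A := by simpa [hAt] using hX4
  have h1 : A * Xᵀ * A = A := by
    have := congrArg transpose hX1
    simpa [hAt, Matrix.mul_assoc] using this
  have hcomm : A * X = A * Xᵀ := by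
    have hs : (A * Xᵀ)ᵀ = A * Xᵀ := by rw [h4, hX4]
    have e : A * X = (A * Xᵀ) * (A * X) := by
      conv_lhs => rw [← h1]
      simp only [Matrix.mul_assoc]
    calc A * X = (A * X)ᵀ := hX3.symm
      _ = ((A * Xᵀ) * (A * X))ᵀ := by rw [← e]
      _ = (A * X) * (A * Xᵀ) := by rw [transpose_mul, hX3, hs]
      _ = (A * X * A) * Xᵀ := by simp only [Matrix.mul_assoc]
      _ = A * Xᵀ := by rw [hX1]
  have hXX : X = (S * J * Xᵀ)ᵀ * (S * J * Xᵀ) := by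
    calc X = X * A * X := hX2.symm
      _ = X * (A * Xᵀ) := by rw [← hcomm, Matrix.mul_assoc]
      _ = _ := by rw [hA, hS]; simp [Matrix.mul_assoc]
  have hnn : 0 ≤ (X * (Jᵀ * (c • (1 : Matrix (Fin m) (Fin m) ℝ) - D) * J)).trace := by
    have h := (hB.mul_mul_conjTranspose_same (S * J * Xᵀ * Jᵀ)).trace_nonneg
    rw [conjTranspose_eq_transpose_of_trivial] at h
    have e : (X * (Jᵀ * (c • (1 : Matrix (Fin m) (Fin m) ℝ) - D) * J)).trace
      = ((S * J * Xᵀ * Jᵀ) * (c • (1 : Matrix (Fin m) (Fin m) ℝ) - D) * (S * J * Xᵀ * Jᵀ)ᵀ).trace := by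
      conv_lhs => rw [hXX]
      rw [Matrix.mul_assoc, Matrix.trace_mul_comm, transpose_mul _ Jᵀ, transpose_transpose]
      simp only [Matrix.mul_assoc]
    rw [e]; exact h
  have hid : IsIdempotentElem (X * A) := by
    show X * A * (X * A) = X * A
    rw [← Matrix.mul_assoc, hX2]
  have hrP : (X * A).rank = A.rank := by
    apply le_antisymm (rank_mul_le_right _ _)
    conv_lhs => rw [← hX1, Matrix.mul_assoc]
    exact rank_mul_le_right _ _
  have htr : (X * A).trace = (J.rank : ℝ) := by
    rw [← hrA, ← hrP]
    have hp : IsIdempotentElem (Matrix.toLin' (X * A)) := by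
      show _ * _ = _
      rw [Module.End.mul_eq_comp, ← Matrix.toLin'_mul, hid.eq]
    have := (LinearMap.IsIdempotentElem.isProj_range _ hp).trace
    rw [Matrix.trace_toLin'_eq] at this
    rw [this]; rfl
  have : X * (Jᵀ * (c • (1 : Matrix (Fin m) (Fin m) ℝ) - D) * J) = c • (X * (Jᵀ * J)) - X * A := by
    rw [hA]; simp [Matrix.mul_sub, Matrix.sub_mul]
  rw [this, trace_sub, trace_smul, htr, smul_eq_mul] at hnn
  rw [div_le_iff₀ hc]; linarith
end

section
/- Let Y = U₁ Σ W₁ᵀ and Ŷ = Û₁ Σ̂ Ŵ₁ᵀ, where U₁, Û₁ ∈ ℝ^{l×r} and W₁, Ŵ₁ ∈ ℝ^{K×r} have orthonormal columns, Σ = diag(σ₁, …, σ_r) with σ₁ ≥ … ≥ σ_r > 0, and Σ̂ ∈ ℝ^{r×r} is diagonal with nonnegative entries. Suppose ρ ≥ 0 is such that ‖Σ̂ − Σ‖₂ ≤ ρ, ‖Û₁ − U₁‖_F ≤ √(2r) ρ / σ_r, and ‖Ŵ₁ − W₁‖_F ≤ √(2r) ρ / σ_r. Then ‖Ŷ − Y‖_F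 ≤ √r · ρ · ( √2 (2σ₁ + ρ)/σ_r + 1 ). -/
open Matrix

/-- The spectral norm (operator norm induced by the Euclidean norm) of a real matrix. -/
noncomputable def specNorm {m n : Type*} [Fintype m] [Fintype n] [DecidableEq n]
    (A : Matrix m n ℝ) : ℝ :=
  ‖LinearMap.toContinuousLinearMap (Matrix.toEuclideanLin A)‖

/-- The Frobenius norm of a real matrix. -/
noncomputable def frobNorm {m n : Type*} [Fintype m] [Fintype n] (A : Matrix m n ℝ) : ℝ :=
  Real.sqrt (∑ i, ∑ j, (A i j) ^ 2)

theorem frobNorm_add_le_aux {m n : Type*} [Fintype m] [Fintype n] (A B : Matrix m n ℝ) :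
    frobNorm (A + B) ≤ frobNorm A + frobNorm B := by
  have key : ∀ C : Matrix m n ℝ, frobNorm C =
      ‖(WithLp.toLp 2 (fun p : m × n => C p.1 p.2) : EuclideanSpace ℝ (m × n))‖ := by
    intro C
    rw [EuclideanSpace.norm_eq, frobNorm, Fintype.sum_prod_type]
    simp
  have hadd : (WithLp.toLp 2 (fun p : m × n => (A + B) p.1 p.2) : EuclideanSpace ℝ (m × n)) =
      WithLp.toLp 2 (fun p : m × n => A p.1 p.2) + WithLp.toLp 2 (fun p : m × n => B p.1 p.2) := by
    rw [← WithLp.toLp_add]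
    congr 1
  rw [key, key, key, hadd]
  apply norm_add_le

theorem frobNorm_eq_trace_aux {m n : Type*} [Fintype m] [Fintype n] (A : Matrix m n ℝ) :
    frobNorm A = Real.sqrt (Matrix.trace (A * Aᵀ)) := by
  unfold frobNorm
  congr 1
  simp [Matrix.trace, Matrix.mul_apply, sq]

theorem frobNorm_transpose_aux {m n : Type*} [Fintype m] [Fintype n] (A : Matrix m n ℝ) :
    frobNorm Aᵀ = frobNorm A := by
  unfold frobNorm
  rw [Finset.sum_comm]
  rfl

theorem frobNorm_mul_orth_aux {m n k : Type*} [Fintype m] [Fintype n] [Fintype k]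
    [DecidableEq n] (A : Matrix m n ℝ) (W : Matrix k n ℝ) (hW : Wᵀ * W = 1) :
    frobNorm (A * Wᵀ) = frobNorm A := by
  rw [frobNorm_eq_trace_aux, frobNorm_eq_trace_aux, Matrix.transpose_mul,
    Matrix.transpose_transpose, Matrix.mul_assoc, ← Matrix.mul_assoc Wᵀ, hW, Matrix.one_mul]

theorem frobNorm_orth_mul_aux {m n k : Type*} [Fintype m] [Fintype n] [Fintype k]
    [DecidableEq n] (A : Matrix n m ℝ) (U : Matrix k n ℝ) (hU : Uᵀ * U = 1) :
    frobNorm (U * A) = frobNorm A := by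
  rw [← frobNorm_transpose_aux, Matrix.transpose_mul, frobNorm_mul_orth_aux _ _ hU,
    frobNorm_transpose_aux]

theorem frobNorm_mul_diagonal_aux {m n : Type*} [Fintype m] [Fintype n] [DecidableEq n]
    (A : Matrix m n ℝ) (d : n → ℝ) (c : ℝ) (hc : 0 ≤ c) (hd : ∀ j, |d j| ≤ c) :
    frobNorm (A * Matrix.diagonal d) ≤ c * frobNorm A := by
  unfold frobNorm
  apply Real.sqrt_le_iff.2
  refine ⟨by positivity, ?_⟩
  rw [mul_pow, Real.sq_sqrt (by positivity), Finset.mul_sum]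
  apply Finset.sum_le_sum
  intro i _
  rw [Finset.mul_sum]
  apply Finset.sum_le_sum
  intro j _
  rw [Matrix.mul_diagonal, mul_pow, mul_comm]
  have := sq_le_sq' (abs_le.1 (hd j)).1 (abs_le.1 (hd j)).2
  gcongr

theorem frobNorm_one_aux (r : ℕ) : frobNorm (1 : Matrix (Fin r) (Fin r) ℝ) = Real.sqrt r := by
  rw [frobNorm_eq_trace_aux]
  simp

theorem abs_le_specNorm_diagonal_aux {n : Type*} [Fintype n] [DecidableEq n]
    (d : n → ℝ) (j : n) : |d j| ≤ specNorm (Matrix.diagonal d) := by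
  have h := (LinearMap.toContinuousLinearMap
    (Matrix.toEuclideanLin (Matrix.diagonal d))).le_opNorm (EuclideanSpace.single j 1)
  have h2 := PiLp.norm_apply_le (LinearMap.toContinuousLinearMap
    (Matrix.toEuclideanLin (Matrix.diagonal d)) (EuclideanSpace.single j 1)) j
  unfold specNorm
  have h3 := h2.trans h
  simpa [Matrix.toLpLin_apply, Matrix.mulVec_diagonal] using h3

/-- Let `Y = U₁ Σ W₁ᵀ` and `Ŷ = Û₁ Σ̂ Ŵ₁ᵀ`, where `U₁, Û₁ ∈ ℝ^{l×r}` and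
`W₁, Ŵ₁ ∈ ℝ^{K×r}` have orthonormal columns, `Σ = diag(σ₁, …, σ_r)` with
`σ₁ ≥ … ≥ σ_r > 0`, and `Σ̂ ∈ ℝ^{r×r}` is diagonal with nonnegative entries.  Suppose
`ρ ≥ 0` is such that `‖Σ̂ − Σ‖₂ ≤ ρ`, `‖Û₁ − U₁‖_F ≤ √(2r) ρ / σ_r`, and
`‖Ŵ₁ − W₁‖_F ≤ √(2r) ρ / σ_r`.  Then
`‖Ŷ − Y‖_F ≤ √r · ρ · ( √2 (2σ₁ + ρ)/σ_r + 1 )`.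
(Here `σ` is zero-indexed: `σ₁ = σ ⟨0,_⟩` and `σ_r = σ ⟨r-1,_⟩`.) -/
theorem frobNorm_tsvd_deterministic_bound
    (l K r : ℕ) (hr : 0 < r)
    (U₁ Uh₁ : Matrix (Fin l) (Fin r) ℝ) (W₁ Wh₁ : Matrix (Fin K) (Fin r) ℝ)
    (σ σh : Fin r → ℝ)
    (hU : U₁ᵀ * U₁ = 1) (hUh : Uh₁ᵀ * Uh₁ = 1)
    (hW : W₁ᵀ * W₁ = 1) (hWh : Wh₁ᵀ * Wh₁ = 1)
    (hσdec : Antitone σ) (hσr : 0 < σ ⟨r - 1, Nat.sub_lt hr one_pos⟩)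
    (hσh : ∀ j, 0 ≤ σh j)
    (ρ : ℝ) (hρ : 0 ≤ ρ)
    (hSg : specNorm (Matrix.diagonal σh - Matrix.diagonal σ) ≤ ρ)
    (hUdiff : frobNorm (Uh₁ - U₁) ≤
      Real.sqrt (2 * r) * ρ / σ ⟨r - 1, Nat.sub_lt hr one_pos⟩)
    (hWdiff : frobNorm (Wh₁ - W₁) ≤
      Real.sqrt (2 * r) * ρ / σ ⟨r - 1, Nat.sub_lt hr one_pos⟩) :
    frobNorm (Uh₁ * Matrix.diagonal σh * Wh₁ᵀ - U₁ * Matrix.diagonal σ * W₁ᵀ) ≤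
      Real.sqrt r * ρ *
        (Real.sqrt 2 * (2 * σ ⟨0, hr⟩ + ρ) / σ ⟨r - 1, Nat.sub_lt hr one_pos⟩ + 1) := by
  have hd : ∀ j, |σh j - σ j| ≤ ρ := fun j => by
    rw [Matrix.diagonal_sub] at hSg
    exact (abs_le_specNorm_diagonal_aux (fun i => σh i - σ i) j).trans hSg
  have hpos : ∀ j, 0 < σ j := fun j => lt_of_lt_of_le hσr (hσdec (by
    rw [Fin.le_def]; have := j.2; simp only; omega))
  have hle : ∀ j, σ j ≤ σ ⟨0, hr⟩ := fun j => hσdec (by rw [Fin.le_def]; simp)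
  have h0 := hpos ⟨0, hr⟩
  have e : Uh₁ * Matrix.diagonal σh * Wh₁ᵀ - U₁ * Matrix.diagonal σ * W₁ᵀ =
      ((Uh₁ - U₁) * Matrix.diagonal σh) * Wh₁ᵀ +
      (U₁ * ((1 * Matrix.diagonal (fun i => σh i - σ i)) * Wh₁ᵀ) +
        U₁ * ((Wh₁ - W₁) * Matrix.diagonal σ)ᵀ) := by
    rw [← Matrix.diagonal_sub, Matrix.transpose_mul, Matrix.diagonal_transpose,
      Matrix.transpose_sub, Matrix.one_mul]
    simp only [Matrix.sub_mul, Matrix.mul_sub, Matrix.mul_assoc]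
    abel
  have b1 : frobNorm (((Uh₁ - U₁) * Matrix.diagonal σh) * Wh₁ᵀ) ≤
      (σ ⟨0, hr⟩ + ρ) * frobNorm (Uh₁ - U₁) := by
    rw [frobNorm_mul_orth_aux _ _ hWh]
    apply frobNorm_mul_diagonal_aux _ _ _ (by positivity)
    intro j
    rw [abs_of_nonneg (hσh j)]
    linarith [(abs_le.1 (hd j)).2, hle j]
  have b2 : frobNorm (U₁ * ((1 * Matrix.diagonal (fun i => σh i - σ i)) * Wh₁ᵀ)) ≤
      ρ * Real.sqrt r := by
    rw [frobNorm_orth_mul_aux _ _ hU, frobNorm_mul_orth_aux _ _ hWh, ← frobNorm_one_aux]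
    exact frobNorm_mul_diagonal_aux _ _ _ hρ hd
  have b3 : frobNorm (U₁ * ((Wh₁ - W₁) * Matrix.diagonal σ)ᵀ) ≤
      σ ⟨0, hr⟩ * frobNorm (Wh₁ - W₁) := by
    rw [frobNorm_orth_mul_aux _ _ hU, frobNorm_transpose_aux]
    apply frobNorm_mul_diagonal_aux _ _ _ h0.le
    intro j
    rw [abs_of_pos (hpos j)]
    exact hle j
  have t1 := mul_le_mul_of_nonneg_left hUdiff (by positivity : 0 ≤ σ ⟨0, hr⟩ + ρ)
  have t3 := mul_le_mul_of_nonneg_left hWdiff h0.le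
  rw [e]
  refine (frobNorm_add_le_aux _ _).trans ?_
  refine (add_le_add (b1.trans t1) ((frobNorm_add_le_aux _ _).trans
    (add_le_add b2 (b3.trans t3)))).trans (le_of_eq ?_)
  rw [Real.sqrt_mul (by norm_num)]
  ring
end
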